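/- arXiv:1403.6933 — 2 statements merged into one kernel-verified Lean document; each statement's English description precedes it below -/
import Mathlib

section
/- For every integer n ≥ 1, the number of ascent sequences of length n that avoid both of the patterns 0010 and 0021 equals the Catalan number C_n = (1/(n+1))·binom(2n,n). -/
/-- The number of ascents of a word of nonnegative integers. -/
def numAscents (w : List ℕ) : ℕ :=
  (w.zip w.tail).countP (fun p => p.1 < p.2)

/-- A word of nonnegative integers is an ascent sequence if it starts with 0 and
each subsequent entry is at most one more than the number of ascents preceding it. -/
def IsAscentSeq (w : List ℕ) : Prop :=
  w.head? = some 0 ∧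
    ∀ i (h : i < w.length), 1 ≤ i → w.get ⟨i, h⟩ ≤ numAscents (w.take i) + 1

/-- A word `π` contains the pattern `τ` if it has a subsequence order-isomorphic to `τ`. -/
def Contains (π τ : List ℕ) : Prop :=
  ∃ f : Fin τ.length → Fin π.length, StrictMono f ∧
    ∀ i j, (π.get (f i) < π.get (f j) ↔ τ.get i < τ.get j) ∧
      (π.get (f i) > π.get (f j) ↔ τ.get i > τ.get j)

/-- A word avoids a pattern if it does not contain it. -/
def Avoids (π τ : List ℕ) : Prop := ¬ Contains π τ

/-- The number of ascent sequences of length `n` avoiding every pattern in `T`. -/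
noncomputable def avoiderCount (n : ℕ) (T : List (List ℕ)) : ℕ :=
  {w : List ℕ | w.length = n ∧ IsAscentSeq w ∧ ∀ τ ∈ T, Avoids w τ}.ncard

/-- The ballot number with `m` up steps and `l` down steps. -/
def ballot (m l : ℕ) : ℤ := (m + l).choose m - (m + l).choose (m + 1)

theorem ballot_zero_right (m : ℕ) : ballot m 0 = 1 := by
  simp [ballot]

theorem ballot_succ_succ (m l : ℕ) :
    ballot (m + 1) (l + 1) = ballot (m + 1) l + ballot m (l + 1) := by
  have e1 : m + 1 + (l + 1) = (m + l + 1) + 1 := by ring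
  have e2 : m + 1 + l = m + l + 1 := by ring
  have e3 : m + (l + 1) = m + l + 1 := by ring
  simp only [ballot, e1, e2, e3]
  rw [Nat.choose_succ_succ (m + l + 1) m, Nat.choose_succ_succ (m + l + 1) (m + 1)]
  push_cast
  ring

theorem ballot_self_succ (m : ℕ) : ballot m (m + 1) = 0 := by
  have h : (m + (m + 1)).choose (m + 1) = (m + (m + 1)).choose m := by
    rw [Nat.choose_symm_add]
  simp [ballot, h]

theorem ballot_self (m : ℕ) : ballot m m = catalan m := by
  have h1 := succ_mul_catalan_eq_centralBinom m
  have h2 := Nat.choose_succ_right_eq (2 * m) m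
  have e : 2 * m - m = m := by omega
  rw [e, ← Nat.centralBinom_eq_two_mul_choose] at h2
  have hp : ((m : ℤ) + 1) ≠ 0 := by positivity
  apply mul_left_cancel₀ hp
  rw [ballot, ← two_mul, ← Nat.centralBinom_eq_two_mul_choose]
  zify at h1 h2
  linear_combination -h1 - h2

theorem ballot_succ_self (m : ℕ) : ballot (m + 1) m = catalan (m + 1) := by
  have h := ballot_succ_succ m m
  rw [ballot_self_succ, ballot_self] at h
  linarith

theorem ballot_succ_left (m l : ℕ) :
    ballot (m + 1) l = ∑ k ∈ Finset.range (l + 1), ballot m k := by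
  induction l with
  | zero => simp [ballot_zero_right]
  | succ l ih => rw [Finset.sum_range_succ, ← ih, ballot_succ_succ]

/-- The pairing of a function with a row of the ballot triangle. -/
def ballotSum (m : ℕ) (h : ℕ → ℤ) : ℤ :=
  ∑ l ∈ Finset.range (m + 1), ballot (m + 1) l * h (m - l)

theorem ballotSum_zero (h : ℕ → ℤ) : ballotSum 0 h = h 0 := by
  simp [ballotSum, ballot_zero_right]

theorem ballotSum_add (m : ℕ) (h₁ h₂ : ℕ → ℤ) :
    ballotSum m (fun j => h₁ j + h₂ j) = ballotSum m h₁ + ballotSum m h₂ := by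
  simp [ballotSum, mul_add, Finset.sum_add_distrib]

theorem ballotSum_sum {ι : Type*} (s : Finset ι) (m : ℕ) (h : ι → ℕ → ℤ) :
    ballotSum m (fun j => ∑ i ∈ s, h i j) = ∑ i ∈ s, ballotSum m (h i) := by
  simp only [ballotSum, Finset.mul_sum]
  exact Finset.sum_comm

theorem ballotSum_const (m : ℕ) (c : ℤ) :
    ballotSum m (fun _ => c) = (catalan (m + 2) - catalan (m + 1)) * c := by
  have h := ballot_succ_succ (m + 1) m
  rw [ballot_succ_self (m + 1), ballot_self] at h
  rw [ballotSum, ← Finset.sum_mul, ← ballot_succ_left, h]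
  · ring

theorem ballotSum_succ (m : ℕ) (h : ℕ → ℤ) :
    ballotSum (m + 1) h = catalan (m + 2) * h 0 +
      ballotSum m (fun j => ∑ i ∈ Finset.range (j + 1), h (i + 1)) := by
  have key : ∑ l ∈ Finset.range (m + 1), ballot (m + 2) l * h (m + 1 - l) =
      ballotSum m (fun j => ∑ i ∈ Finset.range (j + 1), h (i + 1)) := by
    have e1 : ∀ l ∈ Finset.range (m + 1), ballot (m + 2) l * h (m + 1 - l) =
        ∑ k ∈ Finset.range (l + 1), ballot (m + 1) k * h (m + 1 - (k + (l - k))) := by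
      intro l _
      rw [ballot_succ_left, Finset.sum_mul]
      refine Finset.sum_congr rfl fun k hk => ?_
      rw [Finset.mem_range] at hk
      congr 2
      omega
    rw [Finset.sum_congr rfl e1,
      Finset.sum_range_diag_flip (m + 1) (fun k d => ballot (m + 1) k * h (m + 1 - (k + d)))]
    refine Finset.sum_congr rfl fun k hk => ?_
    rw [Finset.mem_range] at hk
    rw [← Finset.mul_sum, ← Finset.sum_range_reflect]
    have e : m + 1 - k = m - k + 1 := by omega
    rw [e]
    congr 1
    refine Finset.sum_congr rfl fun d hd => ?_
    rw [Finset.mem_range] at hd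
    congr 1
    omega
  rw [ballotSum, Finset.sum_range_succ, key, ballot_succ_self, Nat.sub_self, add_comm]

theorem ballotSum_prefix_add_shift (m : ℕ) (h : ℕ → ℤ) :
    ballotSum m (fun j => ∑ i ∈ Finset.range (j + 1), h i) + ballotSum m (fun j => h (j + 1)) +
      catalan (m + 1) * h 0 = ballotSum (m + 1) h := by
  rw [ballotSum_succ, ← ballotSum_add]
  have e : (fun j => ∑ i ∈ Finset.range (j + 1), h i + h (j + 1)) =
      fun j => h 0 + ∑ i ∈ Finset.range (j + 1), h (i + 1) := by
    funext j
    rw [← Finset.sum_range_succ, Finset.sum_range_succ', add_comm]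
  rw [e, ballotSum_add m (fun _ => h 0), ballotSum_const]
  ring

theorem sum_ballotSum_diagonal (m : ℕ) (h : ℕ → ℤ) :
    ∑ d ∈ Finset.range (m + 1), ballotSum (m - d) (fun j => h (j + d)) + h (m + 1) =
      catalan (m + 1) * h 0 + ballotSum m (fun j => h (j + 1)) := by
  induction m generalizing h with
  | zero => simp [ballotSum_zero]
  | succ m ih =>
    have h1 := ih (fun j => h (j + 1))
    have h2 := ballotSum_prefix_add_shift m (fun j => h (j + 1))
    have h3 := ballotSum_succ m h
    rw [Finset.sum_range_succ']
    have e : ∀ d ∈ Finset.range (m + 1),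
        ballotSum (m + 1 - (d + 1)) (fun j => h (j + (d + 1))) =
          ballotSum (m - d) (fun j => h (j + d + 1)) := by
      intro d _
      rw [Nat.add_sub_add_right]
      rfl
    rw [Finset.sum_congr rfl e]
    simp only [Nat.sub_zero, add_zero] at *
    linarith

theorem ballotSum_recurrence (m : ℕ) (h : ℕ → ℤ) :
    ∑ d ∈ Finset.range (m + 1), ballotSum (m - d) (fun j => h (j + d)) +
      ballotSum m (fun j => ∑ i ∈ Finset.range (j + 1), h i) + h (m + 1) =
        ballotSum (m + 1) h := by
  linarith [sum_ballotSum_diagonal m h, ballotSum_prefix_add_shift m h]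

/-- The number of ways to extend by `r` letters an avoider whose last letter has `i` smaller
and `j + 1` larger admissible letters. -/
def extCount : ℕ → ℕ → ℕ → ℕ
  | 0, _, _ => 1
  | r + 1, i, j => ∑ k ∈ Finset.range (i + 1), extCount r k (j + (i - k)) +
      ∑ k ∈ Finset.range (j + 1), extCount r i k

/-- The number of ways to extend the word `0, 1, …, k` by `r` letters to an avoider. -/
def rangeExtCount : ℕ → ℕ → ℕ
  | 0, _ => 1
  | r + 1, k => ∑ i ∈ Finset.range (k + 1), extCount r i (k - i) + rangeExtCount r (k + 1)

theorem sum_ballotSum_extCount_succ (r n : ℕ) :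
    ∑ i ∈ Finset.range n, ballotSum (n - 1 - i) (fun j => extCount (r + 1) i j) +
        rangeExtCount (r + 1) n =
      ∑ i ∈ Finset.range (n + 1), ballotSum (n - i) (fun j => extCount r i j) +
        rangeExtCount r (n + 1) := by
  have e1 : ∀ i ∈ Finset.range n, ballotSum (n - 1 - i) (fun j => extCount (r + 1) i j) =
      ∑ k ∈ Finset.range (i + 1),
          ballotSum (n - 1 - (k + (i - k))) (fun j => extCount r k (j + (i - k))) +
        ballotSum (n - 1 - i) (fun j => ∑ k ∈ Finset.range (j + 1), (extCount r i k : ℤ)) := by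
    intro i _
    simp only [extCount, Nat.cast_add, Nat.cast_sum]
    rw [ballotSum_add, ballotSum_sum]
    congr 1
    refine Finset.sum_congr rfl fun k hk => ?_
    rw [Finset.mem_range] at hk
    congr 1
    omega
  rw [Finset.sum_congr rfl e1, Finset.sum_add_distrib,
    Finset.sum_range_diag_flip n
      (fun k d => ballotSum (n - 1 - (k + d)) (fun j => extCount r k (j + d))),
    ← Finset.sum_add_distrib]
  simp only [rangeExtCount]
  push_cast
  rw [← add_assoc]
  congr 1
  rw [Finset.sum_range_succ, Finset.sum_range_succ, ← add_assoc, ← Finset.sum_add_distrib,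
    Nat.sub_self, ballotSum_zero]
  congr 1
  refine Finset.sum_congr rfl fun i hi => ?_
  rw [Finset.mem_range] at hi
  obtain ⟨m, rfl⟩ : ∃ m, n = i + m + 1 := ⟨n - i - 1, by omega⟩
  have h := ballotSum_recurrence m (fun j => (extCount r i j : ℤ))
  have e2 : i + m + 1 - i = m + 1 := by omega
  have e3 : i + m + 1 - 1 - i = m := by omega
  have e4 : ∀ d, i + m + 1 - 1 - (i + d) = m - d := by omega
  simp only [e2, e3, e4]
  exact h

theorem rangeExtCount_zero_eq_catalan (r : ℕ) : rangeExtCount r 0 = catalan (r + 1) := by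
  have h : ∀ n r, ∑ i ∈ Finset.range n, ballotSum (n - 1 - i) (fun j => extCount r i j) +
      rangeExtCount r n = rangeExtCount (r + n) 0 := by
    intro n
    induction n with
    | zero => simp
    | succ n ih =>
      intro r
      have h1 := sum_ballotSum_extCount_succ r n
      rw [ih] at h1
      rw [show r + (n + 1) = r + 1 + n by ring, h1]
      rfl
  have h0 := h r 0
  simp only [extCount, rangeExtCount, Nat.cast_one, ballotSum_const, mul_one, zero_add] at h0
  rw [Finset.sum_range_reflect (fun i => (catalan (i + 2) - catalan (i + 1) : ℤ)),
    Finset.sum_range_sub (fun i => (catalan (i + 1) : ℤ))] at h0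
  simp at h0
  exact_mod_cast h0.symm
theorem numAscents_concat_concat (w : List ℕ) (y x : ℕ) :
    numAscents (w ++ [y] ++ [x]) = numAscents (w ++ [y]) + if y < x then 1 else 0 := by
  induction w with
  | nil => simp [numAscents, List.countP_cons]
  | cons a w ih =>
    cases w with
    | nil => simp [numAscents, List.countP_cons]; ring
    | cons b w =>
      simp only [numAscents, List.cons_append, List.tail_cons, List.zip_cons_cons,
        List.countP_cons] at ih ⊢
      omega

theorem isAscentSeq_concat {w : List ℕ} (hw : w ≠ []) (x : ℕ) :
    IsAscentSeq (w ++ [x]) ↔ IsAscentSeq w ∧ x ≤ numAscents w + 1 := by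
  have hpos : 0 < w.length := List.length_pos_iff.2 hw
  unfold IsAscentSeq
  rw [List.head?_append_of_ne_nil _ hw, and_assoc]
  refine and_congr_right fun _ => ⟨fun h => ⟨fun i hi h1 => ?_, ?_⟩, fun ⟨h, hx⟩ i hi h1 => ?_⟩
  · have := h i (by simp; omega) h1
    rw [List.take_append_of_le_length hi.le] at this
    simpa [List.getElem_append_left hi] using this
  · have := h w.length (by simp) hpos
    simpa using this
  · rcases Nat.lt_or_ge i w.length with hlt | hge
    · have := h i hlt h1
      rw [List.take_append_of_le_length hlt.le]
      simpa [List.getElem_append_left hlt] using this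
    · obtain rfl : i = w.length := by simp at hi; omega
      simpa using hx

theorem concat_sublist_concat {l w : List ℕ} {x z : ℕ} :
    (l ++ [x]).Sublist (w ++ [z]) ↔ (l ++ [x]).Sublist w ∨ x = z ∧ l.Sublist w := by
  rw [← List.reverse_sublist, ← List.reverse_sublist (l₂ := w), ← List.reverse_sublist (l₁ := l)]
  simp [List.cons_sublist_cons']

theorem contains_iff_exists_sublist {w τ : List ℕ} :
    Contains w τ ↔ ∃ v : List ℕ, ∃ h : v.length = τ.length, v.Sublist w ∧
      ∀ i j : Fin τ.length, (v[i] < v[j] ↔ τ[i] < τ[j]) ∧ (v[i] > v[j] ↔ τ[i] > τ[j]) := by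
  constructor
  · rintro ⟨f, hf, h⟩
    refine ⟨List.ofFn fun i => w.get (f i), by simp, ?_, by simpa using h⟩
    rw [List.sublist_iff_exists_fin_orderEmbedding_get_eq]
    have hl : (List.ofFn fun i => w.get (f i)).length = τ.length := by simp
    refine ⟨OrderEmbedding.ofStrictMono (fun i => f (Fin.cast hl i)) fun i j hij => hf hij, fun i => ?_⟩
    simp
    rfl
  · rintro ⟨v, hv, hs, h⟩
    obtain ⟨f, hf⟩ := List.sublist_iff_exists_fin_orderEmbedding_get_eq.1 hs
    refine ⟨fun i => f (Fin.cast hv.symm i), fun i j hij => f.strictMono hij, fun i j => ?_⟩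
    rw [← hf, ← hf]
    exact h i j

theorem avoids_iff (w : List ℕ) :
    (∀ τ ∈ [[0, 0, 1, 0], [0, 0, 2, 1]], Avoids w τ) ↔
      ∀ a c x, a ≤ x → x < c → ¬ [a, a, c, x].Sublist w := by
  simp only [List.forall_mem_cons, List.not_mem_nil, false_imp_iff, implies_true, and_true,
    Avoids, contains_iff_exists_sublist]
  constructor
  · rintro ⟨h1, h2⟩ a c x hax hxc hs
    rcases hax.eq_or_lt with rfl | hlt
    · refine h1 ⟨[a, a, c, a], rfl, hs, fun i j => ?_⟩
      fin_cases i <;> fin_cases j <;> simp <;> omega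
    · refine h2 ⟨[a, a, c, x], rfl, hs, fun i j => ?_⟩
      fin_cases i <;> fin_cases j <;> simp <;> omega
  · intro h
    constructor
    · rintro ⟨v, hv, hs, hh⟩
      obtain ⟨a, b, c, d, rfl⟩ := List.length_eq_four.1 hv
      have h01 := hh 0 1
      have h02 := hh 0 2
      have h03 := hh 0 3
      simp at h01 h02 h03
      obtain rfl : a = b := by omega
      exact h a c d (by omega) (by omega) hs
    · rintro ⟨v, hv, hs, hh⟩
      obtain ⟨a, b, c, d, rfl⟩ := List.length_eq_four.1 hv
      have h01 := hh 0 1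
      have h23 := hh 2 3
      have h03 := hh 0 3
      simp at h01 h23 h03
      obtain rfl : a = b := by omega
      exact h a c d (by omega) (by omega) hs

/-- Appending `x` to `w` creates an occurrence of `0010` or `0021`. -/
def Forbidden (w : List ℕ) (x : ℕ) : Prop :=
  ∃ a c, a ≤ x ∧ x < c ∧ [a, a, c].Sublist w

/-- An ascent sequence avoiding `0010` and `0021`. -/
def IsAvoider (w : List ℕ) : Prop :=
  IsAscentSeq w ∧ ∀ a c x, a ≤ x → x < c → ¬ [a, a, c, x].Sublist w

open Classical in
/-- The letters that can be appended to the avoider `w`. -/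
noncomputable def nextLetters (w : List ℕ) : Finset ℕ :=
  {x ∈ Finset.range (numAscents w + 2) | ¬ Forbidden w x}

theorem mem_nextLetters {w : List ℕ} {x : ℕ} :
    x ∈ nextLetters w ↔ x ≤ numAscents w + 1 ∧ ¬ Forbidden w x := by
  simp [nextLetters, Nat.lt_succ_iff]

theorem isAvoider_concat {w : List ℕ} (hw : w ≠ []) (x : ℕ) :
    IsAvoider (w ++ [x]) ↔ IsAvoider w ∧ x ∈ nextLetters w := by
  have h : ∀ a c z, [a, a, c, z].Sublist (w ++ [x]) ↔
      [a, a, c, z].Sublist w ∨ z = x ∧ [a, a, c].Sublist w := fun a c z =>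
    concat_sublist_concat (l := [a, a, c])
  simp only [IsAvoider, isAscentSeq_concat hw, mem_nextLetters, Forbidden, h]
  constructor
  · rintro ⟨⟨h1, h2⟩, h3⟩
    exact ⟨⟨h1, fun a c z haz hzc hs => h3 a c z haz hzc (.inl hs)⟩, h2,
      fun ⟨a, c, hax, hxc, hs⟩ => h3 a c x hax hxc (.inr ⟨rfl, hs⟩)⟩
  · rintro ⟨⟨h1, h3⟩, h2, h4⟩
    refine ⟨⟨h1, h2⟩, ?_⟩
    rintro a c z haz hzc (hs | ⟨rfl, hs⟩)
    exacts [h3 a c z haz hzc hs, h4 ⟨a, c, haz, hzc, hs⟩]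

theorem IsAvoider.of_append {w v : List ℕ} (hw : w ≠ []) (h : IsAvoider (w ++ v)) :
    IsAvoider w := by
  induction v using List.reverseRecOn with
  | nil => simpa using h
  | append_singleton v x ih =>
    rw [← List.append_assoc, isAvoider_concat (by simp [hw])] at h
    exact ih h.1

theorem forbidden_concat {w : List ℕ} {z x : ℕ} :
    Forbidden (w ++ [z]) x ↔ Forbidden w x ∨ x < z ∧ ∃ a ≤ x, [a, a].Sublist w := by
  have h : ∀ a c, [a, a, c].Sublist (w ++ [z]) ↔
      [a, a, c].Sublist w ∨ c = z ∧ [a, a].Sublist w := fun a c =>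
    concat_sublist_concat (l := [a, a])
  simp only [Forbidden, h]
  constructor
  · rintro ⟨a, c, hax, hxc, hs | ⟨rfl, hs⟩⟩
    exacts [.inl ⟨a, c, hax, hxc, hs⟩, .inr ⟨hxc, a, hax, hs⟩]
  · rintro (⟨a, c, hax, hxc, hs⟩ | ⟨hxz, a, hax, hs⟩)
    exacts [⟨a, c, hax, hxc, .inl hs⟩, ⟨a, z, hax, hxz, .inr ⟨rfl, hs⟩⟩]

/-- The words `v` of length `r` such that each letter of `v` can be appended in turn to `w`. -/
noncomputable def extensions : ℕ → List ℕ → Finset (List ℕ)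
  | 0, _ => {[]}
  | r + 1, w => (nextLetters w).biUnion fun x => (extensions r (w ++ [x])).image (x :: ·)

theorem mem_extensions {r : ℕ} {w v : List ℕ} (hne : w ≠ []) (hw : IsAvoider w) :
    v ∈ extensions r w ↔ v.length = r ∧ IsAvoider (w ++ v) := by
  induction r generalizing w v with
  | zero =>
    simp only [extensions, Finset.mem_singleton, List.length_eq_zero_iff]
    exact ⟨by rintro rfl; simpa using hw, And.left⟩
  | succ r ih =>
    simp only [extensions, Finset.mem_biUnion, Finset.mem_image]
    constructor
    · rintro ⟨x, hx, u, hu, rfl⟩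
      rw [ih (by simp) ((isAvoider_concat hne x).2 ⟨hw, hx⟩)] at hu
      simpa using hu
    · rintro ⟨hl, hv⟩
      obtain _ | ⟨x, u⟩ := v
      · simp at hl
      rw [List.append_cons] at hv
      have hx := hv.of_append (by simp)
      refine ⟨x, ((isAvoider_concat hne x).1 hx).2, u, ?_, rfl⟩
      rw [ih (by simp) hx]
      exact ⟨by simpa using hl, hv⟩

theorem card_extensions_succ (r : ℕ) (w : List ℕ) :
    (extensions (r + 1) w).card = ∑ x ∈ nextLetters w, (extensions r (w ++ [x])).card := by
  rw [extensions, Finset.card_biUnion]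
  · refine Finset.sum_congr rfl fun x _ => Finset.card_image_of_injective _ ?_
    exact List.cons_injective
  · intro x _ y _ hxy
    rw [Function.onFun, Finset.disjoint_left]
    simp only [Finset.mem_image]
    rintro _ ⟨u, _, rfl⟩ ⟨v, _, h⟩
    exact hxy (List.cons.inj h).1.symm

theorem Finset.sum_card_filter_lt (s : Finset ℕ) (g : ℕ → ℕ) :
    ∑ x ∈ s, g (s.filter (· < x)).card = ∑ i ∈ Finset.range s.card, g i := by
  induction s using Finset.induction_on_max with
  | empty => simp
  | insert m s hm ih =>
    have hms : m ∉ s := fun h => (hm m h).false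
    rw [Finset.sum_insert hms, Finset.card_insert_of_notMem hms, Finset.sum_range_succ, ← ih,
      add_comm]
    congr 1
    · refine Finset.sum_congr rfl fun x hx => ?_
      rw [Finset.filter_insert, if_neg (hm x hx).le.not_gt]
    · rw [Finset.filter_insert, if_neg (lt_irrefl m), Finset.filter_true_of_mem hm]

theorem Finset.sum_card_filter_gt (s : Finset ℕ) (g : ℕ → ℕ) :
    ∑ x ∈ s, g (s.filter (x < ·)).card = ∑ i ∈ Finset.range s.card, g i := by
  induction s using Finset.induction_on_min with
  | empty => simp
  | insert m s hm ih =>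
    have hms : m ∉ s := fun h => (hm m h).false
    rw [Finset.sum_insert hms, Finset.card_insert_of_notMem hms, Finset.sum_range_succ, ← ih,
      add_comm]
    congr 1
    · refine Finset.sum_congr rfl fun x hx => ?_
      rw [Finset.filter_insert, if_neg (hm x hx).le.not_gt]
    · rw [Finset.filter_insert, if_neg (lt_irrefl m), Finset.filter_true_of_mem hm]

theorem Finset.card_filter_lt_add_card_filter_gt {s : Finset ℕ} {x : ℕ} (hx : x ∈ s) :
    (s.filter (· < x)).card + (s.filter (x < ·)).card + 1 = s.card := by
  have h1 := Finset.card_filter_add_card_filter_not (s := s) (· < x)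
  have h2 : s.filter (fun z => ¬ z < x) = insert x (s.filter (x < ·)) := by
    ext z
    simp only [Finset.mem_filter, Finset.mem_insert]
    constructor
    · rintro ⟨hz, hzx⟩
      rcases (not_lt.1 hzx).eq_or_lt with h | h
      exacts [.inl h.symm, .inr ⟨hz, h⟩]
    · rintro (rfl | ⟨hz, hzx⟩)
      exacts [⟨hx, lt_irrefl _⟩, ⟨hz, hzx.not_gt⟩]
  rw [h2, Finset.card_insert_of_notMem (by simp)] at h1
  omega

theorem forbidden_of_lt_last {w : List ℕ} {a x y : ℕ} (hax : a ≤ x) (hxy : x < y)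
    (h : [a, a].Sublist (w ++ [y])) : Forbidden (w ++ [y]) x := by
  refine ⟨a, y, hax, hxy, ?_⟩
  rcases (concat_sublist_concat (l := [a])).1 h with h | ⟨rfl, _⟩
  · exact h.append_right [y]
  · omega

theorem nextLetters_concat_of_le {w : List ℕ} {x y : ℕ} (hxy : x ≤ y) :
    nextLetters (w ++ [y] ++ [x]) = nextLetters (w ++ [y]) := by
  ext z
  rw [mem_nextLetters, mem_nextLetters, numAscents_concat_concat, if_neg hxy.not_gt,
    forbidden_concat, add_zero]
  refine and_congr_right fun _ => not_congr ⟨?_, .inl⟩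
  rintro (h | ⟨hzx, a, haz, hs⟩)
  exacts [h, forbidden_of_lt_last haz (hzx.trans_le hxy) hs]

theorem nextLetters_concat_of_gt {w : List ℕ} {x y : ℕ} (hyx : y < x)
    (hB : ∀ c ∈ w ++ [y], c ≤ numAscents (w ++ [y]))
    (hR : ∃ a ≤ y, [a, a].Sublist (w ++ [y])) (hx : x ∈ nextLetters (w ++ [y])) :
    nextLetters (w ++ [y] ++ [x]) = insert (numAscents (w ++ [y]) + 2)
      ((nextLetters (w ++ [y])).filter fun z => z < y ∨ x ≤ z) := by
  have hx1 := (mem_nextLetters.1 hx).1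
  ext z
  rw [Finset.mem_insert, Finset.mem_filter, mem_nextLetters, mem_nextLetters,
    numAscents_concat_concat, if_pos hyx, forbidden_concat]
  constructor
  · rintro ⟨h1, h2⟩
    rw [not_or] at h2
    by_cases hz : z = numAscents (w ++ [y]) + 2
    · exact .inl hz
    refine .inr ⟨⟨by omega, h2.1⟩, ?_⟩
    by_contra! h
    obtain ⟨a, hay, hs⟩ := hR
    exact h2.2 ⟨h.2, a, hay.trans h.1, hs⟩
  · rintro (rfl | ⟨⟨h1, h2⟩, h3⟩)
    · refine ⟨le_rfl, ?_⟩
      rintro (⟨a, c, _, hc, hs⟩ | ⟨h, _⟩)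
      · have := hB c (hs.subset (by simp))
        omega
      · omega
    · refine ⟨by omega, ?_⟩
      rintro (h | ⟨hzx, a, haz, hs⟩)
      · exact h2 h
      · exact h2 (forbidden_of_lt_last haz (by omega) hs)

theorem card_extensions_eq_extCount (r : ℕ) {w : List ℕ} {y i j : ℕ}
    (hB : ∀ c ∈ w ++ [y], c ≤ numAscents (w ++ [y]))
    (hP : ∀ x, x ∈ w ++ [y] ∨ ∃ a ≤ x, [a, a].Sublist (w ++ [y]))
    (hR : ∃ a ≤ y, [a, a].Sublist (w ++ [y]))
    (hy : y ∈ nextLetters (w ++ [y]))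
    (hi : ((nextLetters (w ++ [y])).filter (· < y)).card = i)
    (hj : ((nextLetters (w ++ [y])).filter (y < ·)).card = j + 1) :
    (extensions r (w ++ [y])).card = extCount r i j := by
  induction r generalizing w y i j with
  | zero => simp [extensions, extCount]
  | succ r ih =>
    have hP' : ∀ x z, z ∈ w ++ [y] ++ [x] ∨ ∃ a ≤ z, [a, a].Sublist (w ++ [y] ++ [x]) := by
      intro x z
      rcases hP z with h | ⟨a, haz, hs⟩
      exacts [.inl (List.mem_append_left _ h),
        .inr ⟨a, haz, hs.trans (List.sublist_append_left _ _)⟩]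
    have hR' : ∀ x, ∃ a ≤ x, [a, a].Sublist (w ++ [y] ++ [x]) := by
      intro x
      rcases hP x with h | ⟨a, hax, hs⟩
      · exact ⟨x, le_rfl, (List.singleton_sublist.2 h).append_right [x]⟩
      · exact ⟨a, hax, hs.trans (List.sublist_append_left _ _)⟩
    have hyB := hB y (by simp)
    have hB' : ∀ x ∈ nextLetters (w ++ [y]), ∀ c ∈ w ++ [y] ++ [x],
        c ≤ numAscents (w ++ [y] ++ [x]) := by
      intro x hx c hc
      have hx1 := (mem_nextLetters.1 hx).1
      rw [numAscents_concat_concat]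
      rcases List.mem_append.1 hc with hc | hc
      · exact (hB c hc).trans (Nat.le_add_right _ _)
      · rw [List.mem_singleton] at hc
        split_ifs <;> omega
    set A := nextLetters (w ++ [y]) with hA
    have hcard := Finset.card_filter_lt_add_card_filter_gt hy
    rw [card_extensions_succ, extCount, ← Finset.sum_filter_add_sum_filter_not A (· ≤ y)]
    simp only [not_le]
    congr 1
    · have hc : (A.filter (· ≤ y)).card = i + 1 := by
        have h := Finset.card_filter_add_card_filter_not (s := A) (· ≤ y)
        simp only [not_le] at h
        omega
      rw [← hc, ← Finset.sum_card_filter_lt]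
      refine Finset.sum_congr rfl fun x hx => ?_
      obtain ⟨hxA, hxy⟩ := Finset.mem_filter.1 hx
      have hn : nextLetters (w ++ [y] ++ [x]) = A := nextLetters_concat_of_le hxy
      have hf : (A.filter (· ≤ y)).filter (· < x) = A.filter (· < x) := by
        rw [Finset.filter_filter]
        exact Finset.filter_congr fun z _ => ⟨And.right, fun h => ⟨by omega, h⟩⟩
      have hle : (A.filter (· < x)).card ≤ (A.filter (· < y)).card :=
        Finset.card_le_card (Finset.monotone_filter_right A fun z _ hz => hz.trans_le hxy)
      have hx' := Finset.card_filter_lt_add_card_filter_gt hxA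
      rw [hf]
      refine ih (hB' x hxA) (hP' x) (hR' x) ?_ ?_ ?_
      · rwa [hn]
      · rw [hn]
      · rw [hn]
        omega
    · have hc : (A.filter (y < ·)).card = j + 1 := hj
      rw [← hc, ← Finset.sum_card_filter_gt]
      refine Finset.sum_congr rfl fun x hx => ?_
      obtain ⟨hxA, hyx⟩ := Finset.mem_filter.1 hx
      have hx1 := (mem_nextLetters.1 hxA).1
      have hn := nextLetters_concat_of_gt hyx hB hR hxA
      rw [← hA] at hn
      have hf : (A.filter (y < ·)).filter (x < ·) = A.filter (x < ·) := by
        rw [Finset.filter_filter]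
        exact Finset.filter_congr fun z _ => ⟨And.right, fun h => ⟨by omega, h⟩⟩
      rw [hf]
      refine ih (hB' x hxA) (hP' x) (hR' x) ?_ ?_ ?_
      · rw [hn]
        simp [hxA]
      · rw [hn, Finset.filter_insert, if_neg (by omega), Finset.filter_filter, ← hi]
        congr 1
        exact Finset.filter_congr fun z _ => by omega
      · rw [hn, Finset.filter_insert, if_pos (by omega), Finset.card_insert_of_notMem,
          Finset.filter_filter]
        · congr 2
          exact Finset.filter_congr fun z _ => by omega
        · intro h
          have := (mem_nextLetters.1 (Finset.mem_filter.1 (Finset.mem_filter.1 h).1).1).1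
          omega

theorem numAscents_range (k : ℕ) : numAscents (List.range (k + 1)) = k := by
  induction k with
  | zero => simp [numAscents]
  | succ k ih =>
    rw [List.range_succ, List.range_succ, numAscents_concat_concat, ← List.range_succ, ih]
    simp

theorem nextLetters_range (k : ℕ) :
    nextLetters (List.range (k + 1)) = Finset.range (k + 2) := by
  ext x
  rw [mem_nextLetters, numAscents_range, Finset.mem_range]
  refine ⟨fun h => by omega, fun h => ⟨by omega, ?_⟩⟩
  rintro ⟨a, c, _, _, hs⟩
  have := hs.nodup List.nodup_range
  simp at this

theorem card_extensions_range (r k : ℕ) :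
    (extensions r (List.range (k + 1))).card = rangeExtCount r k := by
  induction r generalizing k with
  | zero => simp [extensions, rangeExtCount]
  | succ r ih =>
    rw [card_extensions_succ, nextLetters_range, Finset.sum_range_succ, ← List.range_succ, ih,
      rangeExtCount]
    congr 1
    refine Finset.sum_congr rfl fun x hx => ?_
    have hxk : x ≤ k := Nat.lt_succ_iff.1 (Finset.mem_range.1 hx)
    have hn : nextLetters (List.range (k + 1) ++ [x]) = Finset.range (k + 2) := by
      rw [← nextLetters_range, List.range_succ, nextLetters_concat_of_le hxk]
    have hs : [x, x].Sublist (List.range (k + 1) ++ [x]) :=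
      (List.singleton_sublist.2 (List.mem_range.2 (by omega))).append_right [x]
    have hasc : numAscents (List.range (k + 1) ++ [x]) = k := by
      have := numAscents_range k
      rw [List.range_succ] at this ⊢
      rw [numAscents_concat_concat, if_neg (by omega), this, add_zero]
    have hx2 : x ∈ Finset.range (k + 2) := Finset.mem_range.2 (by omega)
    have hlt : ((Finset.range (k + 2)).filter (· < x)).card = x := by
      have : (Finset.range (k + 2)).filter (· < x) = Finset.range x := by
        ext z
        simp only [Finset.mem_filter, Finset.mem_range]
        omega
      rw [this, Finset.card_range]
    have hcard := Finset.card_filter_lt_add_card_filter_gt hx2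
    rw [hlt, Finset.card_range] at hcard
    refine card_extensions_eq_extCount r ?_ (fun z => ?_) ⟨x, le_rfl, hs⟩ ?_ ?_ ?_
    · intro c hc
      rw [hasc]
      simp at hc
      omega
    · rcases Nat.lt_or_ge k z with h | h
      · exact .inr ⟨x, by omega, hs⟩
      · exact .inl (by simp; omega)
    · rwa [hn]
    · rw [hn, hlt]
    · rw [hn]
      omega

theorem isAvoider_singleton_zero : IsAvoider [0] := by
  refine ⟨⟨rfl, fun i hi h1 => ?_⟩, fun a c x _ _ hs => ?_⟩
  · simp at hi
    omega
  · simpa using hs.length_le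

/-- The number of ascent sequences of length `n` avoiding both patterns equals
the Catalan number $C_n$. -/
theorem catalan_count_avoid_0010_0021 (n : ℕ) (hn : 1 ≤ n) :
    avoiderCount n [[0,0,1,0], [0,0,2,1]] = catalan n := by
  obtain ⟨r, rfl⟩ : ∃ r, n = r + 1 := ⟨n - 1, by omega⟩
  have hset : {w : List ℕ | w.length = r + 1 ∧ IsAscentSeq w ∧
      ∀ τ ∈ [[0, 0, 1, 0], [0, 0, 2, 1]], Avoids w τ} =
      ((extensions r [0]).image (0 :: ·) : Finset (List ℕ)) := by
    ext w
    simp only [Set.mem_ofPred_eq, avoids_iff, Finset.coe_image, Set.mem_image, Finset.mem_coe,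
      mem_extensions (List.cons_ne_nil 0 []) isAvoider_singleton_zero]
    constructor
    · rintro ⟨hl, hw⟩
      obtain _ | ⟨x, v⟩ := w
      · simp at hl
      obtain rfl : x = 0 := by simpa using hw.1.1
      exact ⟨v, ⟨by simpa using hl, hw⟩, rfl⟩
    · rintro ⟨v, ⟨hl, hv⟩, rfl⟩
      exact ⟨by simpa using hl, hv⟩
  rw [avoiderCount, hset, Set.ncard_coe_finset,
    Finset.card_image_of_injective _ List.cons_injective, ← rangeExtCount_zero_eq_catalan,
    ← card_extensions_range]
  rfl
end

section
/- For every integer n ≥ 1, the number of ascent sequences of length n that avoid both of the patterns 0122 and 0132 equals the Catalan number C_n = (1/(n+1))·binom(2n,n). -/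
open PowerSeries in
/-- The Catalan generating function with integer coefficients. -/
noncomputable def intCatalanSeries : ℤ⟦X⟧ := catalanSeries.map (Nat.castRingHom ℤ)

open PowerSeries in
theorem intCatalanSeries_eq : intCatalanSeries = 1 + X * intCatalanSeries ^ 2 := by
  have h := congrArg (PowerSeries.map (Nat.castRingHom ℤ)) catalanSeries_sq_mul_X_add_one
  simp only [map_add, map_mul, map_pow, map_one, map_X] at h
  change intCatalanSeries ^ 2 * X + 1 = intCatalanSeries at h
  linear_combination -h

open PowerSeries in
theorem coeff_intCatalanSeries_sq (n : ℕ) :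
    coeff n (intCatalanSeries ^ 2) = (catalan (n + 1) : ℤ) := by
  have h := congrArg (coeff (n + 1)) intCatalanSeries_eq
  simpa [coeff_succ_X_mul, coeff_one, intCatalanSeries, catalanSeries_coeff] using h.symm

open PowerSeries in
/-- The generating function of the continuations of a word whose last letter is positive
and which leaves `t + 1` choices for the next letter exceeding all previous ones. -/
noncomputable def positiveSeries (t : ℕ) : ℤ⟦X⟧ := (1 - X) ^ t * intCatalanSeries ^ (2 * t + 3)

open PowerSeries in
/-- The generating function of the continuations of a word whose last letter is zero
and which leaves `s` choices for the next letter exceeding all previous ones. -/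
noncomputable def zeroSeries (s : ℕ) : ℤ⟦X⟧ :=
  intCatalanSeries ^ 2 +
    ∑ i ∈ Finset.range s, X * (1 - X) ^ i * intCatalanSeries ^ (2 * i + 5)

open PowerSeries in
theorem zeroSeries_eq (s : ℕ) : zeroSeries s =
    1 + X * (zeroSeries s + positiveSeries s + ∑ i ∈ Finset.range s, positiveSeries i) := by
  have h := intCatalanSeries_eq
  induction s with
  | zero =>
    simp only [zeroSeries, positiveSeries, Finset.range_zero, Finset.sum_empty]
    generalize intCatalanSeries = c at *
    linear_combination (1 + c) * h
  | succ s ih =>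
    simp only [zeroSeries, positiveSeries, Finset.sum_range_succ] at ih ⊢
    generalize intCatalanSeries = c at *
    linear_combination ih

open PowerSeries in
theorem positiveSeries_eq (t : ℕ) : positiveSeries t =
    1 + X * (zeroSeries (t + 1) + positiveSeries t +
      ∑ i ∈ Finset.range (t + 1), positiveSeries i) := by
  have h := intCatalanSeries_eq
  induction t with
  | zero =>
    simp only [zeroSeries, positiveSeries, Finset.sum_range_succ, Finset.range_zero,
      Finset.sum_empty]
    generalize intCatalanSeries = c at *
    linear_combination (1 + c + c ^ 2 + X * c ^ 3) * h
  | succ t ih =>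
    simp only [zeroSeries, positiveSeries, Finset.sum_range_succ] at ih ⊢
    generalize intCatalanSeries = c at *
    linear_combination ih + (1 - X) ^ (t + 1) * c ^ (2 * t + 3) * (1 + c + X * c ^ 2) * h

/-- `IsContinuation A M l v` says that `v` may follow a word with `A` ascents, maximum `M`
(or `M = 1` if smaller) and last letter `l`, in an ascent sequence whose letters exceeding `1`
strictly increase. -/
def IsContinuation : ℕ → ℕ → ℕ → List ℕ → Prop
  | _, _, _, [] => True
  | A, M, l, x :: v => x ≤ A + 1 ∧ (x ≤ 1 ∨ M < x) ∧
      IsContinuation (if l < x then A + 1 else A) (max M x) x v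

/-- The continuations of length `n`, in the sense of `IsContinuation`. -/
def continuations : ℕ → ℕ → ℕ → ℕ → Finset (List ℕ)
  | 0, _, _, _ => {[]}
  | n + 1, A, M, l => (insert 0 (insert 1 (Finset.Ioc M (A + 1)))).biUnion fun x =>
      (continuations n (if l < x then A + 1 else A) (max M x) x).image (List.cons x)

theorem mem_continuations (n A M l : ℕ) (v : List ℕ) :
    v ∈ continuations n A M l ↔ v.length = n ∧ IsContinuation A M l v := by
  induction n generalizing A M l v with
  | zero => cases v <;> simp [continuations, IsContinuation]
  | succ n ih =>
    cases v with
    | nil => simp [continuations]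
    | cons x v =>
      have hx : x ∈ insert 0 (insert 1 (Finset.Ioc M (A + 1))) ↔
          x ≤ A + 1 ∧ (x ≤ 1 ∨ M < x) := by
        simp only [Finset.mem_insert, Finset.mem_Ioc]
        omega
      simp only [continuations, Finset.mem_biUnion, Finset.mem_image, List.cons.injEq, ih,
        IsContinuation, List.length_cons]
      constructor
      · rintro ⟨y, hy, w, ⟨hw, hc⟩, rfl, rfl⟩
        exact ⟨by omega, (hx.1 hy).1, (hx.1 hy).2, hc⟩
      · rintro ⟨hl, h₁, h₂, hc⟩
        exact ⟨x, hx.2 ⟨h₁, h₂⟩, v, ⟨by omega, hc⟩, rfl, rfl⟩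

theorem card_continuations_succ {n A M l : ℕ} (hM : 1 ≤ M) :
    (continuations (n + 1) A M l).card =
      (continuations n A M 0).card +
      (continuations n (if l < 1 then A + 1 else A) M 1).card +
      ∑ x ∈ Finset.Ioc M (A + 1), (continuations n (if l < x then A + 1 else A) x x).card := by
  rw [continuations, Finset.card_biUnion]
  · rw [Finset.sum_insert (by simp), Finset.sum_insert (by simp; omega)]
    simp only [Finset.card_image_of_injective _ List.cons_injective, Nat.not_lt_zero, if_false,
      max_eq_left hM, Nat.max_zero, add_assoc]
    congr 2
    refine Finset.sum_congr rfl fun x hx => ?_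
    rw [max_eq_right (Finset.mem_Ioc.1 hx).1.le]
  · intro x _ y _ hxy
    simp only [Finset.disjoint_left, Finset.mem_image]
    rintro _ ⟨v, _, rfl⟩ ⟨w, _, h⟩
    exact hxy (List.cons.inj h).1.symm

open PowerSeries in
theorem card_continuations_eq_coeff (n A M s : ℕ) (hM : 1 ≤ M) :
    (A + 1 = M + s → ((continuations n A M 0).card : ℤ) = coeff n (zeroSeries s)) ∧
    (∀ l, 1 ≤ l → l ≤ M → A = M + s →
      ((continuations n A M l).card : ℤ) = coeff n (positiveSeries s)) := by
  induction n generalizing A M s with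
  | zero =>
    constructor
    · intro _
      rw [zeroSeries_eq]
      simp [continuations]
    · intro l _ _ _
      rw [positiveSeries_eq]
      simp [continuations]
  | succ n ih =>
    have hsum : ∀ l ≤ M, ∀ r, A + 1 = M + r →
        ∑ x ∈ Finset.Ioc M (A + 1),
          ((continuations n (if l < x then A + 1 else A) x x).card : ℤ) =
        ∑ i ∈ Finset.range r, coeff n (positiveSeries i) := by
      intro l hl r hr
      refine Finset.sum_nbij' (fun x => A + 1 - x) (fun i => A + 1 - i) ?_ ?_ ?_ ?_ ?_
      · intro x hx; simp at hx ⊢; omega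
      · intro x hx; simp at hx ⊢; omega
      · intro x hx; simp at hx ⊢; omega
      · intro x hx; simp at hx ⊢; omega
      · intro x hx
        simp only [Finset.mem_Ioc] at hx
        rw [if_pos (by omega)]
        exact (ih (A + 1) x (A + 1 - x) (by omega)).2 x (by omega) le_rfl (by omega)
    constructor
    · intro h
      rw [zeroSeries_eq, card_continuations_succ hM]
      push_cast
      rw [hsum 0 (by omega) s h, (ih A M s hM).1 h,
        (ih (A + 1) M s hM).2 1 le_rfl hM h]
      simp [coeff_succ_X_mul, coeff_one]
    · intro l hl hlM h
      rw [positiveSeries_eq, card_continuations_succ hM]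
      push_cast
      rw [hsum l hlM (s + 1) (by omega), (ih A M (s + 1) hM).1 (by omega), if_neg (by omega),
        (ih A M s hM).2 1 le_rfl hM h]
      simp [coeff_succ_X_mul, coeff_one]

theorem card_continuations_eq_catalan (n : ℕ) :
    (continuations n 0 1 0).card = catalan (n + 1) := by
  have h := (card_continuations_eq_coeff n 0 1 0 le_rfl).1 rfl
  rw [zeroSeries, Finset.range_zero, Finset.sum_empty, add_zero, coeff_intCatalanSeries_sq] at h
  exact_mod_cast h

theorem numAscents_cons_cons (a b : ℕ) (v : List ℕ) :
    numAscents (a :: b :: v) = (if a < b then 1 else 0) + numAscents (b :: v) := by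
  simp [numAscents, List.countP_cons, add_comm]

theorem isContinuation_iff (A M l : ℕ) (hM : 1 ≤ M) (v : List ℕ) :
    IsContinuation A M l v ↔
      (∀ i (h : i < v.length), v[i] ≤ A + numAscents (l :: v.take i) + 1) ∧
      (∀ x ∈ v, 2 ≤ x → M < x) ∧ v.Pairwise (fun a b => 2 ≤ a → 2 ≤ b → a < b) := by
  induction v generalizing A M l with
  | nil => simp [IsContinuation]
  | cons x v ih =>
    rw [IsContinuation, ih _ _ _ (by omega), List.pairwise_cons]
    have hasc : (∀ i (h : i < (x :: v).length),
          (x :: v)[i] ≤ A + numAscents (l :: (x :: v).take i) + 1) ↔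
        x ≤ A + 1 ∧ ∀ i (h : i < v.length),
          v[i] ≤ (if l < x then A + 1 else A) + numAscents (x :: v.take i) + 1 := by
      constructor
      · intro h
        have h₀ := h 0 (by simp)
        rw [List.getElem_cons_zero] at h₀
        refine ⟨by simpa [numAscents] using h₀, fun i hi => ?_⟩
        have := h (i + 1) (by simpa using hi)
        simp only [List.getElem_cons_succ, List.take_succ_cons, numAscents_cons_cons] at this
        split_ifs at this ⊢ <;> omega
      · rintro ⟨h₀, h⟩ i hi
        cases i with
        | zero => simpa [numAscents] using h₀
        | succ i =>
          have := h i (by simpa using hi)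
          simp only [List.getElem_cons_succ, List.take_succ_cons, numAscents_cons_cons]
          split_ifs at this ⊢ <;> omega
    rw [hasc]
    simp only [List.mem_cons, forall_eq_or_imp]
    constructor
    · rintro ⟨h₁, h₂, h₃, h₄, h₅⟩
      exact ⟨⟨h₁, h₃⟩, ⟨by omega, fun y hy h => by have := h₄ y hy h; omega⟩,
        fun y hy _ h => by have := h₄ y hy h; omega, h₅⟩
    · rintro ⟨⟨h₁, h₃⟩, ⟨h₂, h₄⟩, h₅, h₆⟩
      refine ⟨h₁, by omega, h₃, fun y hy h => ?_, h₆⟩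
      have := h₄ y hy h
      have := h₅ y hy
      omega

theorem isAscentSeq_cons_iff (a : ℕ) (v : List ℕ) :
    IsAscentSeq (a :: v) ↔ a = 0 ∧
      ∀ i (h : i < v.length), v[i] ≤ 0 + numAscents (0 :: v.take i) + 1 := by
  simp only [IsAscentSeq, List.head?_cons, Option.some.injEq]
  refine and_congr_right ?_
  rintro rfl
  constructor
  · intro h i hi
    simpa using h (i + 1) (by simpa using hi) (by omega)
  · intro h i hi h1
    obtain ⟨i, rfl⟩ : ∃ j, i = j + 1 := ⟨i - 1, by omega⟩
    simpa using h i (by simpa using hi)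

theorem numAscents_eq_zero {w : List ℕ} (h : ∀ x ∈ w, x = 0) : numAscents w = 0 := by
  simp only [numAscents, List.countP_eq_zero]
  rintro ⟨a, b⟩ hab
  simp [h b (List.mem_of_mem_tail (List.of_mem_zip hab).2)]

theorem IsAscentSeq.getElem_zero {w : List ℕ} (hw : IsAscentSeq w) (h : 0 < w.length) :
    w[0] = 0 := by
  cases w with
  | nil => simp at h
  | cons a v => simpa using hw.1

theorem IsAscentSeq.exists_getElem_eq_one {w : List ℕ} (hw : IsAscentSeq w) (i : ℕ)
    (hi : i < w.length) (h : 2 ≤ w[i]) :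
    ∃ k, ∃ hk : k < i, 0 < k ∧ w[k] = 1 := by
  induction i using Nat.strong_induction_on with
  | _ i ih =>
    have h0 := hw.getElem_zero (by omega)
    have hi0 : i ≠ 0 := by rintro rfl; omega
    by_cases hz : ∀ x ∈ w.take i, x = 0
    · have := hw.2 i hi (by omega)
      rw [numAscents_eq_zero hz] at this
      simp at this
      omega
    · push Not at hz
      obtain ⟨x, hx, hx0⟩ := hz
      obtain ⟨k, hk, rfl⟩ := List.mem_iff_getElem.1 hx
      rw [List.getElem_take] at hx0
      have hki : k < i := by simp at hk; omega
      have hk0 : k ≠ 0 := by rintro rfl; omega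
      by_cases h1 : w[k] = 1
      · exact ⟨k, hki, by omega, h1⟩
      · obtain ⟨m, hm, h⟩ := ih k hki (by omega) (by omega)
        exact ⟨m, by omega, h⟩

theorem contains_of_getElem {w τ : List ℕ} {a b c d p q r s : ℕ} (hτ : τ = [p, q, r, s])
    (hab : a < b) (hbc : b < c) (hcd : c < d) (hd : d < w.length)
    (h : ∀ i j : Fin 4,
      (![w[a], w[b], w[c], w[d]] i < ![w[a], w[b], w[c], w[d]] j ↔
        ![p, q, r, s] i < ![p, q, r, s] j)) :
    Contains w τ := by
  subst hτ
  let f : Fin 4 → Fin w.length :=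
    ![⟨a, by omega⟩, ⟨b, by omega⟩, ⟨c, by omega⟩, ⟨d, hd⟩]
  have hf : ∀ i, w.get (f i) = ![w[a], w[b], w[c], w[d]] i := by
    intro i; fin_cases i <;> rfl
  have hτ : ∀ i : Fin 4, [p, q, r, s].get i = ![p, q, r, s] i := by
    intro i; fin_cases i <;> rfl
  refine ⟨f, ?_, fun i j => ?_⟩
  · refine Fin.strictMono_iff_lt_succ (n := 3).2 fun i => ?_
    fin_cases i
    · exact hab
    · exact hbc
    · exact hcd
  · have key : ∀ i j : Fin 4, (w.get (f i) < w.get (f j) ↔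
        [p, q, r, s].get i < [p, q, r, s].get j) := by
      intro i j
      rw [hf, hf, hτ, hτ]
      exact h i j
    exact ⟨key i j, key j i⟩

theorem not_pairwise_of_contains {w : List ℕ} {r s : ℕ} (hr : 2 ≤ r) (hs : 2 ≤ s)
    (hsr : s ≤ r) (h : Contains w [0, 1, r, s]) :
    ¬ w.Pairwise (fun a b => 2 ≤ a → 2 ≤ b → a < b) := by
  obtain ⟨f, hf, h⟩ := h
  let g : Fin 4 → Fin w.length := f
  have h01 := (h (0 : Fin 4) (1 : Fin 4)).1.2 (by change 0 < 1; omega)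
  have h12 := (h (1 : Fin 4) (2 : Fin 4)).1.2 (by change 1 < r; omega)
  have h13 := (h (1 : Fin 4) (3 : Fin 4)).1.2 (by change 1 < s; omega)
  have h23 : ¬ w.get (g 2) < w.get (g 3) := fun hlt => by
    have : r < s := (h (2 : Fin 4) (3 : Fin 4)).1.1 hlt
    omega
  change w.get (g 0) < w.get (g 1) at h01
  change w.get (g 1) < w.get (g 2) at h12
  change w.get (g 1) < w.get (g 3) at h13
  intro hp
  exact h23 (List.pairwise_iff_get.1 hp (g 2) (g 3)
    (hf (show (2 : Fin 4) < 3 by decide)) (by omega) (by omega))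

theorem IsAscentSeq.avoids_iff_pairwise {w : List ℕ} (hw : IsAscentSeq w) :
    (∀ τ ∈ [[0, 1, 2, 2], [0, 1, 3, 2]], Avoids w τ) ↔
      w.Pairwise (fun a b => 2 ≤ a → 2 ≤ b → a < b) := by
  simp only [List.mem_cons, List.not_mem_nil, or_false, forall_eq_or_imp, forall_eq]
  constructor
  · rintro ⟨h22, h32⟩
    rw [List.pairwise_iff_getElem]
    intro i j hi hj hij h2i h2j
    by_contra hlt
    obtain ⟨k, hki, hk0, hk1⟩ := hw.exists_getElem_eq_one i hi h2i
    have h0 := hw.getElem_zero (by omega)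
    rcases (not_lt.1 hlt).eq_or_lt with heq | hgt
    · refine h22 (contains_of_getElem rfl hk0 hki hij hj fun a b => ?_)
      fin_cases a <;> fin_cases b <;> simp [h0, hk1] <;> omega
    · refine h32 (contains_of_getElem rfl hk0 hki hij hj fun a b => ?_)
      fin_cases a <;> fin_cases b <;> simp [h0, hk1] <;> omega
  · intro hp
    exact ⟨fun h => not_pairwise_of_contains le_rfl le_rfl le_rfl h hp,
      fun h => not_pairwise_of_contains (by omega) le_rfl (by omega) h hp⟩

/-- The number of ascent sequences of length `n` avoiding both patterns equals
the Catalan number $C_n$. -/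
theorem catalan_count_avoid_0122_0132 (n : ℕ) (hn : 1 ≤ n) :
    avoiderCount n [[0,1,2,2], [0,1,3,2]] = catalan n := by
  obtain ⟨n, rfl⟩ : ∃ m, n = m + 1 := ⟨n - 1, by omega⟩
  rw [← card_continuations_eq_catalan, ← Finset.card_image_of_injective _
    (List.cons_injective (a := 0)), ← Set.ncard_coe_finset, avoiderCount]
  congr 1
  ext w
  simp only [Set.mem_ofPred_eq, Finset.coe_image, Set.mem_image, Finset.mem_coe,
    mem_continuations, isContinuation_iff 0 1 0 le_rfl]
  constructor
  · rintro ⟨hl, hw, h⟩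
    rw [hw.avoids_iff_pairwise] at h
    cases w with
    | nil => simp at hl
    | cons a v =>
      obtain ⟨rfl, hasc⟩ := (isAscentSeq_cons_iff a v).1 hw
      exact ⟨v, ⟨by simpa using hl, hasc, fun _ _ h => h, (List.pairwise_cons.1 h).2⟩, rfl⟩
  · rintro ⟨v, ⟨hl, hasc, -, h⟩, rfl⟩
    have hw := (isAscentSeq_cons_iff 0 v).2 ⟨rfl, hasc⟩
    refine ⟨by simpa using hl, hw, hw.avoids_iff_pairwise.2 ?_⟩
    exact List.pairwise_cons.2 ⟨fun _ _ h => by omega, h⟩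
end
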